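/- For a > b > 0, 1/M(a,b) = (2/π) ∫₀^{π/2} dφ / √(a² cos²φ + b² sin²φ), where M(a,b) is the arithmetic-geometric mean of a and b. -/

import Mathlib

open Real Filter

lemma sq_mul_cos_sq_add_sq_mul_sin_sq_pos {a b : ℝ} (ha : 0 < a) (hb : 0 < b) (φ : ℝ) :
    0 < a ^ 2 * cos φ ^ 2 + b ^ 2 * sin φ ^ 2 := by
  by_cases h : cos φ = 0
  · have : sin φ ^ 2 = 1 := by rw [sin_sq, h]; ring
    rw [h, this]; positivity
  · positivity

lemma mul_cos_sq_add_mul_sin_sq_pos {a b : ℝ} (ha : 0 < a) (hb : 0 < b) (φ : ℝ) :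
    0 < a * cos φ ^ 2 + b * sin φ ^ 2 := by
  have := sq_mul_cos_sq_add_sq_mul_sin_sq_pos (sqrt_pos.2 ha) (sqrt_pos.2 hb) φ
  rwa [sq_sqrt ha.le, sq_sqrt hb.le] at this

/-- The integral `∫₀^{π/2} dφ / √(a² cos²φ + b² sin²φ)`. -/
noncomputable def gaussIntegral (a b : ℝ) : ℝ :=
  ∫ φ in (0:ℝ)..(π / 2), 1 / √(a ^ 2 * cos φ ^ 2 + b ^ 2 * sin φ ^ 2)

lemma continuous_gaussIntegrand {a b : ℝ} (ha : 0 < a) (hb : 0 < b) :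
    Continuous fun φ : ℝ => 1 / √(a ^ 2 * cos φ ^ 2 + b ^ 2 * sin φ ^ 2) := by
  refine continuous_const.div (by fun_prop) fun φ => ?_
  exact (sqrt_pos.2 (sq_mul_cos_sq_add_sq_mul_sin_sq_pos ha hb φ)).ne'

lemma integral_zero_pi_gaussIntegrand {a b : ℝ} (ha : 0 < a) (hb : 0 < b) :
    ∫ φ in (0:ℝ)..π, 1 / √(a ^ 2 * cos φ ^ 2 + b ^ 2 * sin φ ^ 2) = 2 * gaussIntegral a b := by
  have hc := continuous_gaussIntegrand ha hb
  rw [← intervalIntegral.integral_add_adjacent_intervals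
    (hc.intervalIntegrable 0 (π / 2)) (hc.intervalIntegrable (π / 2) π)]
  have h := intervalIntegral.integral_comp_sub_left
    (fun φ : ℝ => 1 / √(a ^ 2 * cos φ ^ 2 + b ^ 2 * sin φ ^ 2)) π (a := 0) (b := π / 2)
  simp only [cos_pi_sub, sin_pi_sub, neg_sq, sub_zero, sub_half] at h
  rw [← h, gaussIntegral]
  ring

/-- Landen's substitution `φ ↦ φ + arctan ((b / a) tan φ)`, written so that it is smooth
on the whole line. -/
noncomputable def landen (a b φ : ℝ) : ℝ :=
  2 * φ - arctan ((a - b) * (sin φ * cos φ) / (a * cos φ ^ 2 + b * sin φ ^ 2))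

lemma one_add_landen_arg_sq {a b : ℝ} (ha : 0 < a) (hb : 0 < b) (φ : ℝ) :
    1 + ((a - b) * (sin φ * cos φ) / (a * cos φ ^ 2 + b * sin φ ^ 2)) ^ 2 =
      (a ^ 2 * cos φ ^ 2 + b ^ 2 * sin φ ^ 2) / (a * cos φ ^ 2 + b * sin φ ^ 2) ^ 2 := by
  have hN := (mul_cos_sq_add_mul_sin_sq_pos ha hb φ).ne'
  have h := sin_sq_add_cos_sq φ
  rw [eq_div_iff (pow_ne_zero 2 hN), add_mul, ← mul_pow, div_mul_cancel₀ _ hN]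
  linear_combination (a ^ 2 * cos φ ^ 2 + b ^ 2 * sin φ ^ 2) * h

lemma hasDerivAt_landen {a b : ℝ} (ha : 0 < a) (hb : 0 < b) (φ : ℝ) :
    HasDerivAt (landen a b) ((a + b) * (a * cos φ ^ 2 + b * sin φ ^ 2) /
      (a ^ 2 * cos φ ^ 2 + b ^ 2 * sin φ ^ 2)) φ := by
  have hN := (mul_cos_sq_add_mul_sin_sq_pos ha hb φ).ne'
  have hD := (sq_mul_cos_sq_add_sq_mul_sin_sq_pos ha hb φ).ne'
  have hs := hasDerivAt_sin φ
  have hc := hasDerivAt_cos φ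
  have hx := (((hs.mul hc).const_mul (a - b)).div
    (((hc.pow 2).const_mul a).add ((hs.pow 2).const_mul b)) hN).arctan
  refine (((hasDerivAt_id φ).const_mul 2).sub hx).congr_deriv ?_
  simp only [Pi.mul_apply, Pi.div_apply, Pi.add_apply, Pi.pow_apply]
  rw [one_add_landen_arg_sq ha hb]
  have h4 : sin φ ^ 2 = 1 - cos φ ^ 2 := sin_sq φ
  field_simp
  push_cast
  simp only [h4]
  ring_nf
  simp only [h4]
  ring

lemma cos_landen_sq {a b : ℝ} (ha : 0 < a) (hb : 0 < b) (φ : ℝ) :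
    cos (landen a b φ) ^ 2 =
      (a * cos φ ^ 2 - b * sin φ ^ 2) ^ 2 / (a ^ 2 * cos φ ^ 2 + b ^ 2 * sin φ ^ 2) := by
  have hN := (mul_cos_sq_add_mul_sin_sq_pos ha hb φ).ne'
  have hD := (sq_mul_cos_sq_add_sq_mul_sin_sq_pos ha hb φ).ne'
  have h := sin_sq_add_cos_sq φ
  have hx := one_add_landen_arg_sq ha hb φ
  have hxN : (a - b) * (sin φ * cos φ) / (a * cos φ ^ 2 + b * sin φ ^ 2) *
    (a * cos φ ^ 2 + b * sin φ ^ 2) = (a - b) * (sin φ * cos φ) := div_mul_cancel₀ _ hN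
  rw [landen]
  set x := (a - b) * (sin φ * cos φ) / (a * cos φ ^ 2 + b * sin φ ^ 2)
  have hsin : sin (arctan x) = x * cos (arctan x) := by
    rw [sin_arctan, cos_arctan]; ring
  have hfac : (cos φ ^ 2 - sin φ ^ 2 + 2 * sin φ * cos φ * x) *
      (a * cos φ ^ 2 + b * sin φ ^ 2) = a * cos φ ^ 2 - b * sin φ ^ 2 := by
    linear_combination 2 * sin φ * cos φ * hxN +
      (a * cos φ ^ 2 - b * sin φ ^ 2) * h
  have hcos : cos (2 * φ - arctan x) =
      cos (arctan x) * (cos φ ^ 2 - sin φ ^ 2 + 2 * sin φ * cos φ * x) := by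
    rw [cos_sub, hsin, cos_two_mul', sin_two_mul]; ring
  rw [hcos, mul_pow, cos_sq_arctan, hx, ← hfac]
  field_simp

lemma sqrt_landen {a b : ℝ} (ha : 0 < a) (hb : 0 < b) (φ : ℝ) :
    √(((a + b) / 2) ^ 2 * cos (landen a b φ) ^ 2 + √(a * b) ^ 2 * sin (landen a b φ) ^ 2) =
      (a + b) / 2 * (a * cos φ ^ 2 + b * sin φ ^ 2) /
        √(a ^ 2 * cos φ ^ 2 + b ^ 2 * sin φ ^ 2) := by
  have hN := mul_cos_sq_add_mul_sin_sq_pos ha hb φ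
  have hD := sq_mul_cos_sq_add_sq_mul_sin_sq_pos ha hb φ
  have h4 : sin φ ^ 2 = 1 - cos φ ^ 2 := sin_sq φ
  rw [← sqrt_sq (by positivity : 0 ≤ (a + b) / 2 * (a * cos φ ^ 2 + b * sin φ ^ 2)),
    ← sqrt_div (by positivity), sq_sqrt (by positivity), sin_sq, cos_landen_sq ha hb]
  congr 1
  rw [h4] at hD ⊢
  field_simp
  ring

lemma gaussIntegral_agm_step {a b : ℝ} (ha : 0 < a) (hb : 0 < b) :
    gaussIntegral ((a + b) / 2) √(a * b) = gaussIntegral a b := by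
  have hA : 0 < (a + b) / 2 := by positivity
  have hB : 0 < √(a * b) := by positivity
  have hsub := intervalIntegral.integral_comp_mul_deriv (a := 0) (b := π / 2)
    (fun φ _ => hasDerivAt_landen ha hb φ)
    (Continuous.continuousOn (Continuous.div (by fun_prop) (by fun_prop)
      fun φ => (sq_mul_cos_sq_add_sq_mul_sin_sq_pos ha hb φ).ne'))
    (continuous_gaussIntegrand hA hB)
  have h0 : landen a b 0 = 0 := by simp [landen]
  have h1 : landen a b (π / 2) = π := by simp [landen]; ring
  rw [h0, h1, integral_zero_pi_gaussIntegrand hA hB] at hsub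
  have hint : ∀ φ : ℝ, ((fun φ : ℝ => 1 / √(((a + b) / 2) ^ 2 * cos φ ^ 2 +
      √(a * b) ^ 2 * sin φ ^ 2)) ∘ landen a b) φ *
      ((a + b) * (a * cos φ ^ 2 + b * sin φ ^ 2) / (a ^ 2 * cos φ ^ 2 + b ^ 2 * sin φ ^ 2)) =
      2 * (1 / √(a ^ 2 * cos φ ^ 2 + b ^ 2 * sin φ ^ 2)) := by
    intro φ
    have hN := mul_cos_sq_add_mul_sin_sq_pos ha hb φ
    have hD := sq_mul_cos_sq_add_sq_mul_sin_sq_pos ha hb φ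
    rw [Function.comp_apply, sqrt_landen ha hb]
    have hr := sqrt_pos.2 hD
    have hab : 0 < a + b := by positivity
    nth_rewrite 2 [← sq_sqrt hD.le]
    field_simp
  simp only [hint, intervalIntegral.integral_const_mul] at hsub
  rw [gaussIntegral.eq_1 a b]
  linarith

lemma gaussIntegral_bounds {a b : ℝ} (hb : 0 < b) (hab : b ≤ a) :
    π / 2 * (1 / a) ≤ gaussIntegral a b ∧ gaussIntegral a b ≤ π / 2 * (1 / b) := by
  have ha : 0 < a := hb.trans_le hab
  have hsq : b ^ 2 ≤ a ^ 2 := by gcongr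
  have hi := (continuous_gaussIntegrand ha hb).intervalIntegrable (μ := MeasureTheory.volume)
    0 (π / 2)
  have hpi : (0:ℝ) ≤ π / 2 := by positivity
  have hconst (c : ℝ) : π / 2 * c = ∫ _ in (0:ℝ)..(π / 2), c := by simp
  rw [hconst, hconst]
  constructor
  · refine intervalIntegral.integral_mono_on hpi (by simp) hi fun φ _ => ?_
    have hD := sqrt_pos.2 (sq_mul_cos_sq_add_sq_mul_sin_sq_pos ha hb φ)
    refine one_div_le_one_div_of_le hD (sqrt_le_iff.2 ⟨ha.le, ?_⟩)
    nlinarith [sin_sq_add_cos_sq φ, sq_nonneg (sin φ)]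
  · refine intervalIntegral.integral_mono_on hpi hi (by simp) fun φ _ => ?_
    refine one_div_le_one_div_of_le hb (le_sqrt_of_sq_le ?_)
    nlinarith [sin_sq_add_cos_sq φ, sq_nonneg (cos φ)]

theorem gauss_agm_elliptic_integral (a b : ℝ) (hb : 0 < b) (hab : b < a)
    (A B : ℕ → ℝ) (hA0 : A 0 = a) (hB0 : B 0 = b)
    (hA : ∀ n, A (n + 1) = (A n + B n) / 2)
    (hB : ∀ n, B (n + 1) = Real.sqrt (A n * B n))
    (μ : ℝ) (hμA : Tendsto A atTop (nhds μ)) (hμB : Tendsto B atTop (nhds μ)) :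
    1 / μ = (2 / π) *
      ∫ φ in (0:ℝ)..(π / 2), 1 / Real.sqrt (a ^ 2 * Real.cos φ ^ 2 + b ^ 2 * Real.sin φ ^ 2) := by
  have hinv (n : ℕ) : b ≤ B n ∧ B n ≤ A n ∧ gaussIntegral (A n) (B n) = gaussIntegral a b := by
    induction n with
    | zero => rw [hA0, hB0]; exact ⟨le_rfl, hab.le, rfl⟩
    | succ n ih =>
      obtain ⟨h1, h2, h3⟩ := ih
      have hBn : 0 < B n := hb.trans_le h1
      have hAn : 0 < A n := hBn.trans_le h2
      rw [hA, hB]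
      refine ⟨le_sqrt_of_sq_le ?_, sqrt_le_iff.2 ⟨by positivity, ?_⟩,
        (gaussIntegral_agm_step hAn hBn).trans h3⟩
      · nlinarith
      · nlinarith [sq_nonneg (A n - B n)]
  have hμ : 0 < μ := hb.trans_le (ge_of_tendsto' hμB fun n => (hinv n).1)
  have hlim {C : ℕ → ℝ} (hC : Tendsto C atTop (nhds μ)) :
      Tendsto (fun n => π / 2 * (1 / C n)) atTop (nhds (π / 2 * (1 / μ))) :=
    (tendsto_const_nhds.div hC hμ.ne').const_mul _
  have hbounds (n : ℕ) := gaussIntegral_bounds (hb.trans_le (hinv n).1) (hinv n).2.1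
  have hle : π / 2 * (1 / μ) ≤ gaussIntegral a b :=
    le_of_tendsto' (hlim hμA) fun n => (hinv n).2.2 ▸ (hbounds n).1
  have hge : gaussIntegral a b ≤ π / 2 * (1 / μ) :=
    ge_of_tendsto' (hlim hμB) fun n => (hinv n).2.2 ▸ (hbounds n).2
  change 1 / μ = 2 / π * gaussIntegral a b
  rw [le_antisymm hge hle]
  field_simp
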